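/- Let G be a group and let X and Y be strict G-trees. If all vertex stabilizers of X and Y have property (FA), then there is a unique isomorphism of G-trees X → Y. -/

import Mathlib

universe u

/-- A `G`-tree: a simplicial tree together with an action of `G` by graph
automorphisms without inversions. -/
structure GTree (G : Type u) [Group G] : Type (u + 1) where
  V : Type u
  graph : SimpleGraph V
  isTree : graph.IsTree
  smul : G → V → V
  smul_one : ∀ x, smul 1 x = x
  smul_mul : ∀ γ δ x, smul (γ * δ) x = smul γ (smul δ x)
  smul_adj : ∀ (γ : G) ⦃x y : V⦄, graph.Adj x y → graph.Adj (smul γ x) (smul γ y)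
  no_inversions : ∀ (γ : G) (x y : V), graph.Adj x y → ¬(smul γ x = y ∧ smul γ y = x)

namespace GTree

variable {G : Type u} [Group G]

/-- Oriented edges of a `G`-tree. -/
def Edge (X : GTree G) : Type u := { p : X.V × X.V // X.graph.Adj p.1 p.2 }

/-- Initial vertex `∂₀ e` of an oriented edge. -/
def d0 {X : GTree G} (e : X.Edge) : X.V := e.1.1

/-- Terminal vertex `∂₁ e` of an oriented edge. -/
def d1 {X : GTree G} (e : X.Edge) : X.V := e.1.2

/-- The underlying geometric (unoriented) edge. -/
def esym {X : GTree G} (e : X.Edge) : Sym2 X.V := s(e.1.1, e.1.2)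

/-- Action of `G` on oriented edges. -/
def edgeSmul {X : GTree G} (γ : G) (e : X.Edge) : X.Edge :=
  ⟨(X.smul γ e.1.1, X.smul γ e.1.2), X.smul_adj γ e.2⟩

/-- Vertex stabilizer `G_x`. -/
def stab (X : GTree G) (x : X.V) : Subgroup G where
  carrier := { γ | X.smul γ x = x }
  one_mem' := X.smul_one x
  mul_mem' := by
    intro a b ha hb
    simp only [Set.mem_setOf_eq] at *
    rw [X.smul_mul, hb, ha]
  inv_mem' := by
    intro a ha
    simp only [Set.mem_setOf_eq] at *
    conv_lhs => rw [← ha]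
    rw [← X.smul_mul, inv_mul_cancel, X.smul_one]

/-- Edge stabilizer `G_e`: the elements fixing both endpoints (since the action
is without inversions, these are exactly the elements fixing the edge). -/
def edgeStab (X : GTree G) (e : X.Edge) : Subgroup G :=
  X.stab (d0 e) ⊓ X.stab (d1 e)

/-- An element of `G` is elliptic if it fixes a vertex. -/
def Elliptic (X : GTree G) (γ : G) : Prop := ∃ x, X.smul γ x = x

/-- A subgroup of `G` is elliptic if it fixes a vertex. -/
def FixesVertex (X : GTree G) (H : Subgroup G) : Prop := ∃ x, ∀ γ ∈ H, X.smul γ x = x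

/-- Two `G`-trees have the same elliptic subgroups. -/
def SameEllipticSubgroups (X Y : GTree G) : Prop :=
  ∀ H : Subgroup G, X.FixesVertex H ↔ Y.FixesVertex H

/-- The length function `ℓ_X(γ)`: the minimal vertex displacement. -/
noncomputable def transLen (X : GTree G) (γ : G) : ℕ :=
  sInf (Set.range fun x => X.graph.dist x (X.smul γ x))

/-- Cocompact: the quotient graph `G\X` is finite, i.e. there are finitely
many orbits of vertices and of edges. -/
def Cocompact (X : GTree G) : Prop :=
  Finite (Quot fun x y : X.V => ∃ γ, X.smul γ x = y) ∧
    Finite (Quot fun e f : X.Edge => ∃ γ, edgeSmul γ e = f)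

/-- Reduced: whenever `G_e = G_{∂₀ e}`, the endpoints of `e` are in the same
`G`-orbit. -/
def Reduced (X : GTree G) : Prop :=
  ∀ e : X.Edge, X.edgeStab e = X.stab (d0 e) → ∃ γ, X.smul γ (d0 e) = d1 e

/-- A nonempty `G`-invariant subtree (a nonempty invariant set of vertices that
is connected in the induced graph). -/
def IsInvariantSubtree (X : GTree G) (S : Set X.V) : Prop :=
  S.Nonempty ∧ (∀ γ, ∀ x ∈ S, X.smul γ x ∈ S) ∧
    ∀ x ∈ S, ∀ y ∈ S, ∃ p : X.graph.Walk x y, ∀ v ∈ p.support, v ∈ S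

/-- Minimal: there is no proper nonempty invariant subtree. -/
def Minimal (X : GTree G) : Prop :=
  ∀ S : Set X.V, X.IsInvariantSubtree S → S = Set.univ

/-- Strongly slide-free: minimal, and for all edges `e`, `f` with
`∂₀ e = ∂₀ f`, the inclusion `G_e ⊆ G_f` implies `f ∈ G e`. -/
def StronglySlideFree (X : GTree G) : Prop :=
  X.Minimal ∧ ∀ e f : X.Edge, d0 e = d0 f → X.edgeStab e ≤ X.edgeStab f →
    ∃ γ, edgeSmul γ e = f

/-- Proper: `G_e ⊊ G_{∂₀ e}` for every edge `e`. -/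
def Proper (X : GTree G) : Prop := ∀ e : X.Edge, X.edgeStab e < X.stab (d0 e)

/-- Locally finite: every vertex has finite valence. -/
def LocallyFinite (X : GTree G) : Prop := ∀ x : X.V, (X.graph.neighborSet x).Finite

/-- `φ` is an isomorphism of `G`-trees: an equivariant graph isomorphism. -/
def IsGIso (X Y : GTree G) (φ : X.V → Y.V) : Prop :=
  Function.Bijective φ ∧ (∀ x y, X.graph.Adj x y ↔ Y.graph.Adj (φ x) (φ y)) ∧
    ∀ γ x, φ (X.smul γ x) = Y.smul γ (φ x)

/-- `φ : X → Y` is the collapse move performed at (the orbit of) the edge `e`: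
`G_e = G_{∂₀ e}`, the endpoints of `e` lie in different `G`-orbits, and `Y` is
the equivariant quotient of `X` identifying `∂₀(γ e)` with `∂₁(γ e)` for all
`γ ∈ G`. -/
def IsCollapse (X Y : GTree G) (φ : X.V → Y.V) (e : X.Edge) : Prop :=
  X.edgeStab e = X.stab (d0 e) ∧
  (∀ γ : G, X.smul γ (d0 e) ≠ d1 e) ∧
  Function.Surjective φ ∧
  (∀ γ x, φ (X.smul γ x) = Y.smul γ (φ x)) ∧
  (∀ u v : X.V, φ u = φ v ↔
    Relation.EqvGen (fun a b => ∃ γ : G, a = X.smul γ (d0 e) ∧ b = X.smul γ (d1 e)) u v) ∧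
  (∀ a b : Y.V, a ≠ b → (Y.graph.Adj a b ↔ ∃ u v, X.graph.Adj u v ∧ φ u = a ∧ φ v = b))

/-- `Y` is obtained from `X` by a collapse move. -/
def Collapse (X Y : GTree G) : Prop := ∃ (φ : X.V → Y.V) (e : X.Edge), IsCollapse X Y φ e

/-- Elementary deformation: a finite composition of collapse moves and their
inverses (expansion moves). -/
def ElemDeformation : GTree G → GTree G → Prop := Relation.EqvGen Collapse

end GTree

/-- A group `H` has property (FA) if every `H`-tree has a global fixed
point. -/
def PropertyFA (H : Type u) [Group H] : Prop :=
  ∀ T : GTree H, ∃ v : T.V, ∀ h : H, T.smul h v = v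

namespace GTree

variable {G : Type u} [Group G]

/-- A `G`-tree is strict if no edge stabilizer contains the stabilizer of
another geometric edge or of a vertex. -/
def Strict (X : GTree G) : Prop :=
  ∀ e : X.Edge,
    (∀ f : X.Edge, esym f ≠ esym e → ¬ X.edgeStab f ≤ X.edgeStab e) ∧
    (∀ x : X.V, ¬ X.stab x ≤ X.edgeStab e)

end GTree

namespace GTree

variable {G : Type u} [Group G]

/-- The restriction of a `G`-tree to a subgroup. -/
def restrict (X : GTree G) (H : Subgroup G) : GTree H where
  V := X.V
  graph := X.graph
  isTree := X.isTree
  smul h := X.smul h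
  smul_one := X.smul_one
  smul_mul γ δ := X.smul_mul γ δ
  smul_adj γ := X.smul_adj γ
  no_inversions γ := X.no_inversions γ

theorem mem_stab {X : GTree G} {x : X.V} {γ : G} : γ ∈ X.stab x ↔ X.smul γ x = x := Iff.rfl

theorem smul_injective (X : GTree G) (γ : G) : Function.Injective (X.smul γ) := by
  intro x y h
  have h' := congrArg (X.smul γ⁻¹) h
  rwa [← X.smul_mul, ← X.smul_mul, inv_mul_cancel, X.smul_one, X.smul_one] at h'

/-- An element fixing both ends of a path fixes its second vertex. -/
theorem smul_snd_eq (X : GTree G) {γ : G} {a b : X.V} (p : X.graph.Walk a b) (hp : p.IsPath)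
    (ha : X.smul γ a = a) (hb : X.smul γ b = b) : X.smul γ p.snd = p.snd := by
  let f : X.graph →g X.graph := ⟨X.smul γ, fun h => X.smul_adj γ h⟩
  have hq : ((p.map f).copy ha hb).IsPath := by
    simpa using hp.map (f := f) (X.smul_injective γ)
  have h := congrArg (fun w => w.getVert 1)
    ((X.isTree.existsUnique_path a b).unique hq hp)
  simpa [f] using h

/-- A subgroup fixing two distinct vertices fixes an edge at the first of them. -/
theorem exists_adj_le_stab (X : GTree G) {H : Subgroup G} {a b : X.V} (hab : a ≠ b)
    (ha : H ≤ X.stab a) (hb : H ≤ X.stab b) : ∃ c, X.graph.Adj a c ∧ H ≤ X.stab c := by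
  obtain ⟨p, hp, -⟩ := X.isTree.existsUnique_path a b
  exact ⟨p.snd, p.adj_snd (SimpleGraph.Walk.not_nil_of_ne hab),
    fun γ hγ => X.smul_snd_eq p hp (ha hγ) (hb hγ)⟩

theorem Strict.eq_of_stab_le {X : GTree G} (hX : X.Strict) {x y : X.V}
    (h : X.stab x ≤ X.stab y) : x = y := by
  by_contra hne
  obtain ⟨c, hc, hfix⟩ := X.exists_adj_le_stab hne le_rfl h
  exact (hX ⟨(x, c), hc⟩).2 x (le_inf le_rfl hfix)

/-- In a strict tree, an edge stabilizer fixes only the ends of the edge. -/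
theorem Strict.eq_or_eq_of_inf_le {X : GTree G} (hX : X.Strict) {a b c : X.V}
    (hab : X.graph.Adj a b) (h : X.stab a ⊓ X.stab b ≤ X.stab c) : c = a ∨ c = b := by
  by_contra! hne
  obtain ⟨d, hcd, hd⟩ := X.exists_adj_le_stab hne.1 h inf_le_left
  refine (hX ⟨(c, d), hcd⟩).1 ⟨(a, b), hab⟩ ?_ (le_inf h hd)
  intro heq
  have hc : c ∈ s(a, b) := by
    rw [show s(a, b) = s(c, d) from heq]
    exact Sym2.mem_mk_left c d
  rcases Sym2.mem_iff.1 hc with hc | hc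
  exacts [hne.1 hc, hne.2 hc]

theorem exists_stab_le (X Y : GTree G) (x : X.V) (hx : PropertyFA (X.stab x)) :
    ∃ y, X.stab x ≤ Y.stab y := by
  obtain ⟨y, hy⟩ := hx (Y.restrict (X.stab x))
  exact ⟨y, fun γ hγ => hy ⟨γ, hγ⟩⟩

theorem Strict.exists_stab_eq {X Y : GTree G} (hX : X.Strict) (x : X.V)
    (hx : PropertyFA (X.stab x)) (hY : ∀ y : Y.V, PropertyFA (Y.stab y)) :
    ∃ y, Y.stab y = X.stab x := by
  obtain ⟨y, hy⟩ := exists_stab_le X Y x hx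
  obtain ⟨z, hz⟩ := exists_stab_le Y X y (hY y)
  obtain rfl := hX.eq_of_stab_le (hy.trans hz)
  exact ⟨y, hz.antisymm hy⟩

theorem mem_stab_smul (X : GTree G) (γ δ : G) (x : X.V) :
    δ ∈ X.stab (X.smul γ x) ↔ γ⁻¹ * δ * γ ∈ X.stab x := by
  rw [mem_stab, mem_stab, X.smul_mul, X.smul_mul]
  refine ⟨fun h => ?_, fun h => ?_⟩
  · rw [h, ← X.smul_mul, inv_mul_cancel, X.smul_one]
  · apply X.smul_injective γ⁻¹
    rw [h, ← X.smul_mul, inv_mul_cancel, X.smul_one]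

/-- A stabilizer-preserving surjection from a strict tree preserves adjacency. -/
theorem Strict.adj_map {X Y : GTree G} (hX : X.Strict) {φ : X.V → Y.V}
    (hφ : Function.Surjective φ) (hstab : ∀ x, Y.stab (φ x) = X.stab x) {a b : X.V}
    (hab : X.graph.Adj a b) : Y.graph.Adj (φ a) (φ b) := by
  have hne : φ a ≠ φ b := fun h =>
    hab.ne (hX.eq_of_stab_le (by rw [← hstab a, ← hstab b, h]))
  obtain ⟨d, hd, hfix⟩ := Y.exists_adj_le_stab (H := X.stab a ⊓ X.stab b) hne
    (inf_le_left.trans (hstab a).ge) (inf_le_right.trans (hstab b).ge)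
  obtain ⟨c, rfl⟩ := hφ d
  rw [hstab] at hfix
  rcases hX.eq_or_eq_of_inf_le hab hfix with rfl | rfl
  exacts [(hd.ne rfl).elim, hd]

theorem IsGIso.stab_eq {X Y : GTree G} {φ : X.V → Y.V} (h : IsGIso X Y φ) (x : X.V) :
    Y.stab (φ x) = X.stab x := by
  ext γ
  rw [mem_stab, mem_stab, ← h.2.2, h.1.1.eq_iff]

end GTree

open GTree in
/-- Theorem 6.7: let `X` and `Y` be strict `G`-trees whose vertex stabilizers
all have property (FA).  Then there is a unique isomorphism of `G`-trees
`X → Y`. -/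
theorem strict_rigidity {G : Type u} [Group G] (X Y : GTree G)
    (hXs : X.Strict) (hYs : Y.Strict)
    (hFAX : ∀ x : X.V, PropertyFA ↥(X.stab x))
    (hFAY : ∀ y : Y.V, PropertyFA ↥(Y.stab y)) :
    ∃! φ : X.V → Y.V, IsGIso X Y φ := by
  choose φ hφ using fun x => hXs.exists_stab_eq x (hFAX x) hFAY
  choose ψ hψ using fun y => hYs.exists_stab_eq y (hFAY y) hFAX
  have hψφ : Function.LeftInverse ψ φ := fun x =>
    hXs.eq_of_stab_le (by rw [hψ, hφ])
  have hφψ : Function.RightInverse ψ φ := fun y =>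
    hYs.eq_of_stab_le (by rw [hφ, hψ])
  refine ⟨φ, ⟨⟨hψφ.injective, hφψ.surjective⟩, fun x y => ⟨?_, fun h => ?_⟩, fun γ x => ?_⟩, ?_⟩
  · exact hXs.adj_map hφψ.surjective hφ
  · simpa only [hψφ x, hψφ y] using hYs.adj_map hψφ.surjective hψ h
  · refine hYs.eq_of_stab_le (le_of_eq ?_)
    ext δ
    rw [hφ, mem_stab_smul, mem_stab_smul, hφ]
  · intro χ hχ
    funext x
    exact hYs.eq_of_stab_le (by rw [hχ.stab_eq, hφ])
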